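/- There exists a constant C > 0 depending only on n with the following property: if Q, Q′ ⊂ ℝⁿ are two closed dyadic cubes with side lengths satisfying (1/4)·l(Q′) ≤ l(Q) ≤ 4·l(Q′) and such that Ω := int(Q ∪ Q′) is connected, then for every u ∈ BV(Ω): ∫_Ω |u(y) − u_Ω| dy ≤ C · l(Q) · ‖Du‖(Ω), where u_Ω := (1/|Ω|) ∫_Ω u(y) dy. -/

import Mathlib

open MeasureTheory Metric Set Filter Topology
open scoped ENNReal NNReal Topology

noncomputable section

/-- Euclidean space `ℝⁿ`. -/
abbrev En (n : ℕ) := EuclideanSpace ℝ (Fin n)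

variable {n : ℕ}

/-- The divergence of a vector field `φ : ℝⁿ → ℝⁿ`. -/
def divg (φ : En n → En n) (x : En n) : ℝ :=
  ∑ i, fderiv ℝ φ x (EuclideanSpace.single i 1) i

/-- The total variation `‖Du‖(Ω)` of `u` on `Ω`, defined as
`sup { ∫_Ω u div φ : φ ∈ C¹_c(Ω; ℝⁿ), |φ| ≤ 1 }` (as an extended real; the supremum
of a family symmetric under `φ ↦ -φ`, so taking `ENNReal.ofReal` of each term loses
nothing). -/
def tvE (Ω : Set (En n)) (u : En n → ℝ) : ℝ≥0∞ :=
  ⨆ φ ∈ {φ : En n → En n | ContDiff ℝ 1 φ ∧ HasCompactSupport φ ∧ tsupport φ ⊆ Ω ∧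
      ∀ x, ‖φ x‖ ≤ 1},
    ENNReal.ofReal (∫ x in Ω, u x * divg φ x)

/-- `u ∈ BV(Ω)`: `u ∈ L¹(Ω)` and `u` has finite total variation on `Ω`. -/
def MemBV (Ω : Set (En n)) (u : En n → ℝ) : Prop :=
  IntegrableOn u Ω volume ∧ tvE Ω u < ⊤

/-- The `BV(Ω)`-norm `‖u‖_{L¹(Ω)} + ‖Du‖(Ω)`. -/
def bvNorm (Ω : Set (En n)) (u : En n → ℝ) : ℝ :=
  (∫ x in Ω, |u x|) + (tvE Ω u).toReal

/-- The closed dyadic cube `2^{-k}([0,1]ⁿ + m)`, of side length `2^{-k}`. -/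
def dyadicCube (k : ℤ) (m : Fin n → ℤ) : Set (En n) :=
  {x | ∀ i, (m i : ℝ) * (2 : ℝ) ^ (-k) ≤ x i ∧ x i ≤ ((m i : ℝ) + 1) * (2 : ℝ) ^ (-k)}

/-- A bounded-by-one smooth test function supported in an open set can be chosen to agree with
`1` and `-1` on two prescribed disjoint compact subsets. -/
theorem exists_contDiff_eq_one_eq_neg_one {V K L : Set (En n)} (hV : IsOpen V)
    (hK : IsCompact K) (hL : IsCompact L) (hKL : Disjoint K L) (hKV : K ⊆ V) (hLV : L ⊆ V) :
    ∃ ψ : En n → ℝ, ContDiff ℝ 1 ψ ∧ HasCompactSupport ψ ∧ tsupport ψ ⊆ V ∧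
      (∀ x, |ψ x| ≤ 1) ∧ (∀ x ∈ K, ψ x = 1) ∧ ∀ x ∈ L, ψ x = -1 := by
  obtain ⟨K', hK', hKLK', hK'V⟩ := exists_compact_between (hK.union hL) hV (union_subset hKV hLV)
  obtain ⟨θ, hθ0, hθ1, hθ⟩ := exists_contMDiffMap_zero_one_of_isClosed (n := 1)
    (modelWithCornersSelf ℝ (En n)) hL.isClosed hK.isClosed hKL.symm
  obtain ⟨χ, hχ0, hχ1, hχ⟩ := exists_contMDiffMap_zero_one_of_isClosed (n := 1)
    (modelWithCornersSelf ℝ (En n)) (isOpen_interior (s := K')).isClosed_compl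
    (hK.union hL).isClosed (disjoint_compl_left_iff_subset.2 hKLK')
  have hsupp : ∀ x ∉ K', (2 * θ x - 1) * χ x = 0 := fun x hx => by
    have : χ x = 0 := hχ0 fun h => hx (interior_subset h)
    simp [this]
  refine ⟨fun x => (2 * θ x - 1) * χ x, ?_, HasCompactSupport.intro hK' hsupp, ?_, ?_, ?_, ?_⟩
  · have h1 : ContDiff ℝ 1 θ := θ.contMDiff.contDiff
    have h2 : ContDiff ℝ 1 χ := χ.contMDiff.contDiff
    exact ((contDiff_const.mul h1).sub contDiff_const).mul h2
  · refine (closure_minimal (fun x hx => ?_) hK'.isClosed).trans hK'V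
    by_contra h
    exact hx (hsupp x h)
  · intro x
    rw [abs_mul]
    have h1 := hθ x
    have h2 := hχ x
    refine mul_le_one₀ (abs_le.2 ⟨?_, ?_⟩) (abs_nonneg _) (abs_le.2 ⟨?_, ?_⟩) <;>
      linarith [h1.1, h1.2, h2.1, h2.2]
  · intro x hx
    have h1 : θ x = 1 := hθ1 hx
    have h2 : χ x = 1 := hχ1 (Or.inl hx)
    simp only [h1, h2]; norm_num
  · intro x hx
    have h1 : θ x = 0 := hθ0 hx
    have h2 : χ x = 1 := hχ1 (Or.inr hx)
    simp only [h1, h2]; norm_num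

/-- The `L¹` norm of a function vanishing off an open set is bounded by duality with `C¹`
test functions compactly supported in that set. -/
theorem integral_abs_le_of_forall_integral_mul_le {V : Set (En n)} (hV : IsOpen V)
    {w : En n → ℝ} (hwm : Measurable w) (hw : Integrable w) (hwV : ∀ x ∉ V, w x = 0) {M : ℝ}
    (h : ∀ ψ : En n → ℝ, ContDiff ℝ 1 ψ → HasCompactSupport ψ → tsupport ψ ⊆ V →
      (∀ x, |ψ x| ≤ 1) → ∫ x, w x * ψ x ≤ M) :
    ∫ x, |w x| ≤ M := by
  refine le_of_forall_pos_le_add fun ε hε => ?_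
  set ν : Measure (En n) := volume.withDensity fun x => ‖w x‖ₑ with hν
  have : IsFiniteMeasure ν := isFiniteMeasure_withDensity hw.hasFiniteIntegral.ne
  have hPm : MeasurableSet {x | 0 < w x} := measurableSet_lt measurable_const hwm
  have hNm : MeasurableSet {x | w x < 0} := measurableSet_lt hwm measurable_const
  have hε4 : ENNReal.ofReal (ε / 4) ≠ 0 := by simpa using by positivity
  obtain ⟨K, hKP, hK, hKε⟩ := hPm.exists_isCompact_sdiff_lt (measure_ne_top ν _) hε4
  obtain ⟨L, hLN, hL, hLε⟩ := hNm.exists_isCompact_sdiff_lt (measure_ne_top ν _) hε4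
  have hKL : Disjoint K L := disjoint_left.2 fun x hx hx' => lt_asymm (show 0 < w x from hKP hx) (hLN hx')
  obtain ⟨ψ, hψ, hψc, hψV, hψ1, hψK, hψL⟩ := exists_contDiff_eq_one_eq_neg_one hV hK hL hKL
    (fun x hx => by_contra fun hc => (hKP hx).ne' (hwV x hc))
    (fun x hx => by_contra fun hc => (hLN hx).ne (hwV x hc))
  have hS : MeasurableSet (({x | 0 < w x} \ K) ∪ ({x | w x < 0} \ L)) :=
    (hPm.diff hK.measurableSet).union (hNm.diff hL.measurableSet)
  set S := ({x | 0 < w x} \ K) ∪ ({x | w x < 0} \ L) with hSdef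
  have hSε : ∫ x in S, |w x| ≤ ε / 2 := by
    have h1 : ∫⁻ x in S, ‖w x‖ₑ ≤ ENNReal.ofReal (ε / 2) := by
      rw [← withDensity_apply _ hS]
      calc ν S ≤ ν ({x | 0 < w x} \ K) + ν ({x | w x < 0} \ L) := measure_union_le _ _
        _ ≤ ENNReal.ofReal (ε / 4) + ENNReal.ofReal (ε / 4) := add_le_add hKε.le hLε.le
        _ = ENNReal.ofReal (ε / 2) := by
          rw [← ENNReal.ofReal_add (by positivity) (by positivity)]; congr 1; ring
    have h2 := integral_norm_eq_lintegral_enorm (hw.1.restrict (s := S))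
    simp only [Real.norm_eq_abs] at h2
    rw [h2]
    exact ENNReal.toReal_le_of_le_ofReal (by positivity) h1
  have hwψ : Integrable fun x => w x * ψ x :=
    hw.mul_bdd (c := 1) hψ.continuous.aestronglyMeasurable (Eventually.of_forall hψ1)
  have hint : Integrable fun x => w x * ψ x + 2 * S.indicator (fun x => |w x|) x :=
    hwψ.add ((hw.abs.indicator hS).const_mul 2)
  calc ∫ x, |w x| ≤ ∫ x, (w x * ψ x + 2 * S.indicator (fun x => |w x|) x) := by
        refine integral_mono hw.abs hint fun x => ?_
        have h1 := abs_le.1 (hψ1 x)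
        rcases lt_trichotomy (w x) 0 with hx | hx | hx
        · by_cases hxL : x ∈ L
          · have : 0 ≤ S.indicator (fun x => |w x|) x := indicator_nonneg (fun _ _ => abs_nonneg _) _
            simp only [hψL x hxL, abs_of_neg hx]; linarith
          · have : S.indicator (fun x => |w x|) x = |w x| := indicator_of_mem (s := S) (Or.inr ⟨hx, hxL⟩) _
            simp only [this, abs_of_neg hx]; nlinarith
        · simp [hx, indicator]
        · by_cases hxK : x ∈ K
          · have : 0 ≤ S.indicator (fun x => |w x|) x := indicator_nonneg (fun _ _ => abs_nonneg _) _
            simp only [hψK x hxK, abs_of_pos hx]; linarith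
          · have : S.indicator (fun x => |w x|) x = |w x| := indicator_of_mem (s := S) (Or.inl ⟨hx, hxK⟩) _
            simp only [this, abs_of_pos hx]; nlinarith
    _ = (∫ x, w x * ψ x) + 2 * ∫ x in S, |w x| := by
        rw [integral_add hwψ ((hw.abs.indicator hS).const_mul 2), integral_const_mul,
          integral_indicator hS]
    _ ≤ M + ε := by linarith [h ψ hψ hψc hψV hψ1]

/-- Averaging a `C¹` function along the segment from `x - h` to `x` gives a `C¹` function whose
derivative in direction `h` is a difference of the original function. -/
theorem contDiff_segment_average {ψ : En n → ℝ} (hψ : ContDiff ℝ 1 ψ) (hc : HasCompactSupport ψ)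
    (h : En n) :
    ContDiff ℝ 1 (fun x => ∫ t in (0 : ℝ)..1, ψ (x - t • h)) ∧
      ∀ x, fderiv ℝ (fun x => ∫ t in (0 : ℝ)..1, ψ (x - t • h)) x h = ψ x - ψ (x - h) := by
  have hd : Differentiable ℝ ψ := hψ.differentiable one_ne_zero
  have hcf : Continuous (fderiv ℝ ψ) := hψ.continuous_fderiv one_ne_zero
  obtain ⟨C, hC⟩ := (hc.fderiv (𝕜 := ℝ)).exists_bound_of_continuous hcf
  have hψc := hψ.continuous
  have hderiv : ∀ x, HasFDerivAt (fun x => ∫ t in (0 : ℝ)..1, ψ (x - t • h))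
      (∫ t in (0 : ℝ)..1, fderiv ℝ ψ (x - t • h)) x := fun x => by
    refine intervalIntegral.hasFDerivAt_integral_of_dominated_of_fderiv_le (𝕜 := ℝ) (s := univ)
      (F := fun x t => ψ (x - t • h)) (F' := fun x t => fderiv ℝ ψ (x - t • h))
      (bound := fun _ => C) univ_mem (Eventually.of_forall fun y => ?_) ?_ ?_ ?_ ?_ ?_
    · exact Continuous.aestronglyMeasurable (by fun_prop)
    · exact Continuous.intervalIntegrable (by fun_prop) _ _
    · exact Continuous.aestronglyMeasurable (by fun_prop)
    · exact Eventually.of_forall fun t _ y _ => hC _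
    · exact intervalIntegrable_const
    · refine Eventually.of_forall fun t _ y _ => ?_
      have := (hd (y - t • h)).hasFDerivAt.comp y ((hasFDerivAt_id y).sub_const (t • h))
      simpa using! this
  refine ⟨contDiff_one_iff_hasFDerivAt.2 ⟨_, ?_, hderiv⟩, fun x => ?_⟩
  · exact intervalIntegral.continuous_parametric_intervalIntegral_of_continuous'
      (by fun_prop) _ _
  · rw [(hderiv x).fderiv, ContinuousLinearMap.intervalIntegral_apply
      (Continuous.intervalIntegrable (by fun_prop) _ _)]
    have hs : ∀ t ∈ uIcc (0 : ℝ) 1, HasDerivAt (fun t : ℝ => -ψ (x - t • h))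
        (fderiv ℝ ψ (x - t • h) h) t := fun t _ => by
      have h1 : HasDerivAt (fun t : ℝ => x - t • h) (-h) t := by
        simpa using ((hasDerivAt_id t).smul_const h).const_sub x
      have h2 := ((hd (x - t • h)).hasFDerivAt.comp_hasDerivAt t h1).neg
      rw [map_neg, neg_neg] at h2
      exact h2
    rw [intervalIntegral.integral_eq_sub_of_hasDerivAt hs
      (Continuous.intervalIntegrable (by fun_prop) _ _)]
    simp; ring

theorem divg_smul_const {f : En n → ℝ} (hf : Differentiable ℝ f) (v x : En n) :
    divg (fun y => f y • v) x = fderiv ℝ f x v := by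
  have hv : v = ∑ i, v i • EuclideanSpace.single i (1 : ℝ) := by
    ext j
    simp [Finset.sum_apply, Pi.single_apply]
  have h1 : fderiv ℝ (fun y => f y • v) x = (fderiv ℝ f x).smulRight v :=
    ((hf x).hasFDerivAt.smul_const v).fderiv
  conv_rhs => rw [hv, map_sum]
  simp only [divg, h1]
  refine Finset.sum_congr rfl fun i _ => ?_
  simp [mul_comm]

theorem integral_mul_fderiv_le_tvE {U : Set (En n)} {u f : En n → ℝ} (htv : tvE U u ≠ ⊤)
    (hf : ContDiff ℝ 1 f) (hfc : HasCompactSupport f) (hfU : tsupport f ⊆ U)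
    (hf1 : ∀ x, |f x| ≤ 1) (v : En n) :
    ∫ x in U, u x * fderiv ℝ f x v ≤ ‖v‖ * (tvE U u).toReal := by
  rcases eq_or_ne v 0 with rfl | hv
  · simp
  have hv' : ‖v‖ ≠ 0 := norm_ne_zero_iff.2 hv
  set e : En n := ‖v‖⁻¹ • v with he
  have he1 : ‖e‖ = 1 := by rw [he, norm_smul, norm_inv, norm_norm, inv_mul_cancel₀ hv']
  have hve : v = ‖v‖ • e := by rw [he, smul_smul, mul_inv_cancel₀ hv', one_smul]
  have hφ : (fun y => f y • e) ∈ {φ : En n → En n | ContDiff ℝ 1 φ ∧ HasCompactSupport φ ∧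
      tsupport φ ⊆ U ∧ ∀ x, ‖φ x‖ ≤ 1} := by
    refine ⟨hf.smul contDiff_const, hfc.smul_right, ?_, fun x => ?_⟩
    · exact (closure_mono (Function.support_smul_subset_left f fun _ => e)).trans hfU
    · rw [norm_smul, he1, mul_one]
      exact hf1 x
  have h1 : ENNReal.ofReal (∫ x in U, u x * divg (fun y => f y • e) x) ≤ tvE U u :=
    le_iSup₂ (f := fun φ (_ : φ ∈ {φ : En n → En n | ContDiff ℝ 1 φ ∧ HasCompactSupport φ ∧
      tsupport φ ⊆ U ∧ ∀ x, ‖φ x‖ ≤ 1}) => ENNReal.ofReal (∫ x in U, u x * divg φ x)) _ hφ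
  have h2 : ∫ x in U, u x * divg (fun y => f y • e) x ≤ (tvE U u).toReal :=
    (ENNReal.ofReal_le_iff_le_toReal htv).1 h1
  simp only [divg_smul_const (hf.differentiable one_ne_zero)] at h2
  calc ∫ x in U, u x * fderiv ℝ f x v = ∫ x in U, ‖v‖ * (u x * fderiv ℝ f x e) := by
        congr 1; ext x
        conv_lhs => rw [hve, map_smul, smul_eq_mul]
        ring
    _ = ‖v‖ * ∫ x in U, u x * fderiv ℝ f x e := integral_const_mul _ _
    _ ≤ _ := mul_le_mul_of_nonneg_left h2 (norm_nonneg _)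

/-- The difference quotient bound for functions of bounded variation on a convex open set. -/
theorem integral_abs_translate_sub_le {U : Set (En n)} (hU : IsOpen U) (hUc : Convex ℝ U)
    {u : En n → ℝ} (hum : Measurable u) (hu : IntegrableOn u U) (htv : tvE U u ≠ ⊤) (h : En n) :
    Integrable ({x | x ∈ U ∧ x + h ∈ U}.indicator fun x => u (x + h) - u x) ∧
    ∫ x, |{x | x ∈ U ∧ x + h ∈ U}.indicator (fun x => u (x + h) - u x) x|
      ≤ ‖h‖ * (tvE U u).toReal := by
  set V : Set (En n) := {x | x ∈ U ∧ x + h ∈ U} with hV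
  have hVo : IsOpen V := hU.inter (hU.preimage (by fun_prop : Continuous fun x : En n => x + h))
  set g := U.indicator u with hg
  have hgi : Integrable g := hu.integrable_indicator hU.measurableSet
  have hgh : Integrable fun x => g (x + h) := hgi.comp_add_right h
  have hw : V.indicator (fun x => u (x + h) - u x) = V.indicator fun x => g (x + h) - g x := by
    refine indicator_congr fun x hx => ?_
    simp only [hg, indicator_of_mem hx.1, indicator_of_mem hx.2]
  have hwi : Integrable (V.indicator fun x => u (x + h) - u x) := by
    rw [hw]; exact (hgh.sub hgi).indicator hVo.measurableSet
  refine ⟨hwi, integral_abs_le_of_forall_integral_mul_le hVo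
    (Measurable.indicator (by fun_prop) hVo.measurableSet) hwi
    (fun x hx => indicator_of_notMem hx _) fun ψ hψ hψc hψV hψ1 => ?_⟩
  obtain ⟨hΨ, hΨd⟩ := contDiff_segment_average hψ hψc h
  set Ψ : En n → ℝ := fun x => ∫ t in (0 : ℝ)..1, ψ (x - t • h) with hΨdef
  have hK : IsCompact ((fun p : En n × ℝ => p.1 + p.2 • h) '' (tsupport ψ ×ˢ Icc 0 1)) :=
    (IsCompact.prod hψc isCompact_Icc).image (by fun_prop)
  set K := (fun p : En n × ℝ => p.1 + p.2 • h) '' (tsupport ψ ×ˢ Icc 0 1) with hKdef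
  have hKU : K ⊆ U := by
    rintro _ ⟨⟨x, t⟩, ⟨hx, ht⟩, rfl⟩
    have := hψV hx
    exact hUc.add_smul_mem this.1 this.2 ht
  have hΨK : ∀ x ∉ K, Ψ x = 0 := fun x hx => by
    rw [hΨdef]
    refine (intervalIntegral.integral_congr fun t ht => ?_).trans
      intervalIntegral.integral_zero
    rw [uIcc_of_le zero_le_one] at ht
    by_contra hne
    exact hx ⟨(x - t • h, t), ⟨subset_tsupport _ hne, ht⟩, by simp⟩
  have hΨs : Function.support Ψ ⊆ K := fun x hx => by_contra fun hxK => hx (hΨK x hxK)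
  have hΨU : tsupport Ψ ⊆ U := (closure_minimal hΨs hK.isClosed).trans hKU
  have hΨ1 : ∀ x, |Ψ x| ≤ 1 := fun x => by
    have := intervalIntegral.norm_integral_le_of_norm_le_const (a := 0) (b := 1) (C := 1)
      (f := fun t : ℝ => ψ (x - t • h)) fun t _ => hψ1 _
    simpa using this
  have hψb : ∀ {f : En n → ℝ}, Integrable f → ∀ y, Integrable fun x => f x * ψ (x - y) :=
    fun hf y => hf.mul_bdd (c := 1)
      (hψ.continuous.comp (by fun_prop : Continuous fun x : En n => x - y)).aestronglyMeasurable
      (Eventually.of_forall fun x => hψ1 _)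
  have hψb0 : ∀ {f : En n → ℝ}, Integrable f → Integrable fun x => f x * ψ x :=
    fun hf => by simpa using hψb hf 0
  have hshift : ∫ x, g (x + h) * ψ x = ∫ x, g x * ψ (x - h) := by
    rw [← integral_add_right_eq_self (fun x => g x * ψ (x - h)) h]
    simp
  calc ∫ x, V.indicator (fun x => u (x + h) - u x) x * ψ x
      = ∫ x, (g (x + h) * ψ x - g x * ψ x) := by
        rw [hw]
        congr 1; ext x
        by_cases hx : x ∈ V
        · rw [indicator_of_mem hx]; ring
        · have : ψ x = 0 := image_eq_zero_of_notMem_tsupport fun hc => hx (hψV hc)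
          simp [this]
    _ = ∫ x, (g x * ψ (x - h) - g x * ψ x) := by
        rw [integral_sub (hψb0 hgh) (hψb0 hgi), hshift,
          integral_sub (hψb hgi h) (hψb0 hgi)]
    _ = ∫ x, U.indicator (fun x => u x * fderiv ℝ Ψ x (-h)) x := by
        congr 1; ext x
        have hd : fderiv ℝ Ψ x (-h) = ψ (x - h) - ψ x := by
          rw [(fderiv ℝ Ψ x).map_neg, hΨd, neg_sub]
        by_cases hx : x ∈ U
        · simp only [hg, indicator_of_mem hx, hd]; ring
        · simp [hg, hx]
    _ = ∫ x in U, u x * fderiv ℝ Ψ x (-h) := integral_indicator hU.measurableSet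
    _ ≤ ‖-h‖ * (tvE U u).toReal := integral_mul_fderiv_le_tvE htv hΨ
        (HasCompactSupport.intro hK hΨK) hΨU hΨ1 (-h)
    _ = ‖h‖ * (tvE U u).toReal := by rw [norm_neg]

/-- A Poincaré inequality in double integral form on bounded convex open sets. -/
theorem lintegral_lintegral_enorm_sub_le {U : Set (En n)} (hU : IsOpen U) (hUc : Convex ℝ U)
    {u : En n → ℝ} (hum : Measurable u) (hu : IntegrableOn u U) (htv : tvE U u ≠ ⊤) {d : ℝ}
    (hd : ∀ x ∈ U, ∀ y ∈ U, ‖x - y‖ ≤ d) :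
    ∫⁻ x in U, ∫⁻ y in U, ‖u y - u x‖ₑ ≤
      ENNReal.ofReal (d * (tvE U u).toReal) * volume (closedBall (0 : En n) d) := by
  set F : En n → En n → ℝ≥0∞ := fun x h =>
    {x | x ∈ U ∧ x + h ∈ U}.indicator (fun x => ‖u (x + h) - u x‖ₑ) x with hF
  have hFm : Measurable (Function.uncurry F) := by
    have hS : MeasurableSet {p : En n × En n | p.1 ∈ U ∧ p.1 + p.2 ∈ U} :=
      (hU.measurableSet.preimage measurable_fst).inter
        (hU.measurableSet.preimage (measurable_fst.add measurable_snd))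
    have : Measurable fun p : En n × En n => ‖u (p.1 + p.2) - u p.1‖ₑ := by fun_prop
    exact this.indicator hS
  have hmono : ∀ h, ∫⁻ x, F x h ≤
      (closedBall (0 : En n) d).indicator (fun _ => ENNReal.ofReal (d * (tvE U u).toReal)) h := by
    intro h
    by_cases hne : ∃ x, x ∈ U ∧ x + h ∈ U
    · obtain ⟨x, hx, hxh⟩ := hne
      have hhd : ‖h‖ ≤ d := by simpa using hd _ hxh _ hx
      rw [indicator_of_mem (by simpa using hhd)]
      obtain ⟨hi, hle⟩ := integral_abs_translate_sub_le hU hUc hum hu htv h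
      have h1 := ofReal_integral_norm_eq_lintegral_enorm hi
      calc ∫⁻ x, F x h
          = ∫⁻ x, ‖{x | x ∈ U ∧ x + h ∈ U}.indicator (fun x => u (x + h) - u x) x‖ₑ := by
            simp only [hF, enorm_indicator_eq_indicator_enorm]
        _ = ENNReal.ofReal _ := h1.symm
        _ ≤ ENNReal.ofReal (d * (tvE U u).toReal) :=
            ENNReal.ofReal_le_ofReal (hle.trans
              (mul_le_mul_of_nonneg_right hhd ENNReal.toReal_nonneg))
    · push Not at hne
      have : ∀ x, F x h = 0 := fun x => indicator_of_notMem (fun hx => hne x hx.1 hx.2) _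
      simp [this]
  calc ∫⁻ x in U, ∫⁻ y in U, ‖u y - u x‖ₑ
      = ∫⁻ x, ∫⁻ h, F x h := by
        rw [← lintegral_indicator hU.measurableSet]
        refine lintegral_congr fun x => ?_
        by_cases hx : x ∈ U
        · rw [indicator_of_mem hx, ← lintegral_indicator hU.measurableSet,
            ← lintegral_add_left_eq_self _ x]
          refine lintegral_congr fun h => ?_
          by_cases hxh : x + h ∈ U <;> simp [hF, hx, hxh]
        · simp [hF, hx]
    _ = ∫⁻ h, ∫⁻ x, F x h := lintegral_lintegral_swap hFm.aemeasurable
    _ ≤ ∫⁻ h, (closedBall (0 : En n) d).indicator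
          (fun _ => ENNReal.ofReal (d * (tvE U u).toReal)) h := lintegral_mono hmono
    _ = _ := by
        rw [lintegral_indicator measurableSet_closedBall, setLIntegral_const]

theorem tvE_mono {U Ω : Set (En n)} (hUΩ : U ⊆ Ω) (u : En n → ℝ) : tvE U u ≤ tvE Ω u := by
  refine iSup₂_le fun φ hφ => ?_
  refine le_iSup₂_of_le φ ⟨hφ.1, hφ.2.1, hφ.2.2.1.trans hUΩ, hφ.2.2.2⟩ ?_
  have hz : ∀ x ∉ U, u x * divg φ x = 0 := fun x hx => by
    have : fderiv ℝ φ x = 0 := by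
      refine image_eq_zero_of_notMem_tsupport fun hc => hx (hφ.2.2.1 ?_)
      exact tsupport_fderiv_subset ℝ hc
    simp [divg, this]
  rw [setIntegral_eq_integral_of_forall_compl_eq_zero hz,
    setIntegral_eq_integral_of_forall_compl_eq_zero fun x hx => hz x fun h => hx (hUΩ h)]

/-- On a set of finite measure, the mean minimizes the `L¹` distance to constants up to a
factor of two. -/
theorem setIntegral_abs_sub_mean_le {Ω : Set (En n)} (hΩ : volume Ω ≠ ⊤) {u : En n → ℝ}
    (hu : IntegrableOn u Ω) (c : ℝ) :
    ∫ y in Ω, |u y - (∫ z in Ω, u z) / (volume Ω).toReal| ≤ 2 * ∫ y in Ω, |u y - c| := by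
  have hc : ∀ a : ℝ, IntegrableOn (fun _ => a) Ω := fun a => integrableOn_const hΩ
  have hi : IntegrableOn (fun y => |u y - c|) Ω := (hu.sub (hc c)).abs
  rcases eq_or_ne (volume Ω) 0 with h0 | h0
  · simp [Measure.restrict_eq_zero.2 h0]
  have hv : 0 < (volume Ω).toReal := ENNReal.toReal_pos h0 hΩ
  set a := (∫ z in Ω, u z) / (volume Ω).toReal with ha
  have h1 : (c - a) * (volume Ω).toReal = -∫ y in Ω, (u y - c) := by
    rw [integral_sub hu (hc c), setIntegral_const, ha, Measure.real, smul_eq_mul]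
    field_simp
    ring
  have h2 : |c - a| * (volume Ω).toReal ≤ ∫ y in Ω, |u y - c| := by
    rw [← abs_of_pos hv, ← abs_mul, h1, abs_neg]
    exact abs_integral_le_integral_abs
  calc ∫ y in Ω, |u y - a| ≤ ∫ y in Ω, (|u y - c| + |c - a|) :=
        integral_mono (hu.sub (hc a)).abs (hi.add (hc _)) fun y => abs_sub_le _ _ _
    _ = (∫ y in Ω, |u y - c|) + |c - a| * (volume Ω).toReal := by
        rw [integral_add hi (hc _), setIntegral_const, Measure.real, smul_eq_mul, mul_comm |c - a|]
    _ ≤ 2 * ∫ y in Ω, |u y - c| := by linarith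

/-- A Poincaré inequality on a set covered, up to measure zero, by two bounded convex open
subsets whose intersection contains a ball. -/
theorem setIntegral_abs_sub_mean_le_of_cover {Ω A B : Set (En n)} (hΩ : volume Ω ≠ ⊤)
    (hA : IsOpen A) (hAc : Convex ℝ A) (hAΩ : A ⊆ Ω) (hB : IsOpen B) (hBc : Convex ℝ B)
    (hBΩ : B ⊆ Ω) (hcov : volume (Ω \ (A ∪ B)) = 0) {d r : ℝ} (hr : 0 < r) (hrd : 0 < d)
    (hdA : ∀ x ∈ A, ∀ y ∈ A, ‖x - y‖ ≤ d) (hdB : ∀ x ∈ B, ∀ y ∈ B, ‖x - y‖ ≤ d)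
    {z : En n} (hz : closedBall z r ⊆ A ∩ B) {u : En n → ℝ} (hum : Measurable u)
    (hu : IntegrableOn u Ω) (htv : tvE Ω u ≠ ⊤) :
    ∫ y in Ω, |u y - (∫ z in Ω, u z) / (volume Ω).toReal| ≤
      4 * (d / r) ^ n * d * (tvE Ω u).toReal := by
  set T := (tvE Ω u).toReal with hT
  set E := closedBall z r with hE
  have hT0 : 0 ≤ T := ENNReal.toReal_nonneg
  have hE0 : volume E ≠ 0 := (measure_closedBall_pos _ _ hr).ne'
  have hEtop : volume E ≠ ⊤ := measure_closedBall_lt_top.ne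
  have hball : volume (closedBall (0 : En n) d) = ENNReal.ofReal ((d / r) ^ n) * volume E := by
    have h1 := Measure.addHaar_closedBall_mul_of_pos (volume : Measure (En n)) 0 (div_pos hrd hr) r
    rw [div_mul_cancel₀ _ hr.ne', finrank_euclideanSpace_fin] at h1
    rw [h1, hE, Measure.addHaar_closedBall_center _ z]
  have hD : ∀ U : Set (En n), IsOpen U → Convex ℝ U → U ⊆ Ω → (∀ x ∈ U, ∀ y ∈ U, ‖x - y‖ ≤ d) →
      E ⊆ U → ∫⁻ x in E, ∫⁻ y in U, ‖u y - u x‖ₑ ≤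
        ENNReal.ofReal (d * T) * (ENNReal.ofReal ((d / r) ^ n) * volume E) := by
    intro U hU hUc hUΩ hdU hEU
    have hle : tvE U u ≤ tvE Ω u := tvE_mono hUΩ u
    calc ∫⁻ x in E, ∫⁻ y in U, ‖u y - u x‖ₑ ≤ ∫⁻ x in U, ∫⁻ y in U, ‖u y - u x‖ₑ :=
          lintegral_mono_set hEU
      _ ≤ ENNReal.ofReal (d * (tvE U u).toReal) * volume (closedBall (0 : En n) d) :=
          lintegral_lintegral_enorm_sub_le hU hUc hum (hu.mono_set hUΩ)
            (ne_top_of_le_ne_top htv hle) hdU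
      _ ≤ ENNReal.ofReal (d * T) * volume (closedBall (0 : En n) d) := by
          gcongr
          exact ENNReal.toReal_mono htv hle
      _ = _ := by rw [hball]
  have hm : ∀ U : Set (En n), Measurable fun x => ∫⁻ y in U, ‖u y - u x‖ₑ := fun U =>
    Measurable.lintegral_prod_right' (f := fun p : En n × En n => ‖u p.2 - u p.1‖ₑ) (by fun_prop)
  obtain ⟨x, -, hx⟩ := exists_le_setLAverage hE0 hEtop ((hm A).add (hm B)).aemeasurable.restrict
  have hcd : 0 ≤ (d / r) ^ n := by positivity
  have h2 : ∀ a : ℝ, 2 * ENNReal.ofReal a = ENNReal.ofReal (2 * a) := fun a => by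
    rw [ENNReal.ofReal_mul zero_le_two, ENNReal.ofReal_ofNat]
  have hx' : ∫⁻ y in Ω, ‖u y - u x‖ₑ ≤ ENNReal.ofReal (2 * (d / r) ^ n * d * T) := by
    calc ∫⁻ y in Ω, ‖u y - u x‖ₑ ≤ ∫⁻ y in A ∪ B, ‖u y - u x‖ₑ :=
          lintegral_mono' (Measure.restrict_mono_ae (ae_le_set.2 hcov)) le_rfl
      _ ≤ (∫⁻ y in A, ‖u y - u x‖ₑ) + ∫⁻ y in B, ‖u y - u x‖ₑ := lintegral_union_le _ _ _
      _ ≤ _ := hx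
      _ ≤ ENNReal.ofReal (2 * (d / r) ^ n * d * T) := by
        rw [setLAverage_eq]
        refine ENNReal.div_le_of_le_mul ?_
        simp only [Pi.add_apply]
        rw [lintegral_add_left (hm A)]
        refine (add_le_add (hD A hA hAc hAΩ hdA fun y hy => (hz hy).1)
          (hD B hB hBc hBΩ hdB fun y hy => (hz hy).2)).trans_eq ?_
        rw [← two_mul, ← mul_assoc (ENNReal.ofReal _), ← ENNReal.ofReal_mul (by positivity),
          ← mul_assoc, h2]
        congr 2; ring
  have hi : IntegrableOn (fun y => u y - u x) Ω := hu.sub (integrableOn_const hΩ)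
  have hx'' : ∫ y in Ω, |u y - u x| ≤ 2 * (d / r) ^ n * d * T := by
    have h1 := integral_norm_eq_lintegral_enorm hi.aestronglyMeasurable
    simp only [Real.norm_eq_abs] at h1
    rw [h1]
    exact ENNReal.toReal_le_of_le_ofReal (by positivity) hx'
  linarith [setIntegral_abs_sub_mean_le hΩ hu (u x)]

/-- The closed box with opposite corners `a` and `b`. -/
def closedBox (a b : Fin n → ℝ) : Set (En n) := {x | ∀ i, a i ≤ x i ∧ x i ≤ b i}

theorem convex_closedBox (a b : Fin n → ℝ) : Convex ℝ (closedBox a b) := by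
  intro x hx y hy s t hs ht hst i
  have h1 := hx i
  have h2 := hy i
  simp only [PiLp.add_apply, PiLp.smul_apply, smul_eq_mul]
  have h3 : a i = s * a i + t * a i := by rw [← add_mul, hst, one_mul]
  have h4 : b i = s * b i + t * b i := by rw [← add_mul, hst, one_mul]
  rw [h3, h4]
  constructor
  · exact add_le_add (mul_le_mul_of_nonneg_left h1.1 hs) (mul_le_mul_of_nonneg_left h2.1 ht)
  · exact add_le_add (mul_le_mul_of_nonneg_left h1.2 hs) (mul_le_mul_of_nonneg_left h2.2 ht)

theorem norm_sub_le_of_mem_closedBox {a b : Fin n → ℝ} {L : ℝ} (hL : 0 ≤ L)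
    (hab : ∀ i, b i - a i ≤ L) {x y : En n} (hx : x ∈ closedBox a b) (hy : y ∈ closedBox a b) :
    ‖x - y‖ ≤ (n + 1) * L := by
  rw [EuclideanSpace.norm_eq]
  refine Real.sqrt_le_iff.2 ⟨by positivity, ?_⟩
  calc ∑ i, ‖(x - y) i‖ ^ 2 ≤ ∑ _i : Fin n, L ^ 2 := by
        refine Finset.sum_le_sum fun i _ => ?_
        have h1 := hx i
        have h2 := hy i
        have h3 := hab i
        rw [Real.norm_eq_abs, sq_abs, PiLp.sub_apply]
        exact sq_le_sq' (by linarith) (by linarith)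
    _ = n * L ^ 2 := by simp
    _ ≤ ((n + 1) * L) ^ 2 := by
        have : (0 : ℝ) ≤ n := Nat.cast_nonneg n
        nlinarith [mul_nonneg this (sq_nonneg L), mul_nonneg (mul_nonneg this this) (sq_nonneg L),
          sq_nonneg L]

theorem ball_subset_closedBox {a b : Fin n → ℝ} {z : En n} {r : ℝ}
    (h : ∀ i, a i ≤ z i - r ∧ z i + r ≤ b i) : ball z r ⊆ closedBox a b := by
  intro x hx i
  have h1 : |x i - z i| ≤ ‖x - z‖ := by simpa using PiLp.norm_apply_le (x - z) i
  rw [mem_ball, dist_eq_norm] at hx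
  have h2 := abs_le.1 (h1.trans hx.le)
  have h3 := h i
  constructor <;> linarith

/-- If two cubes lie on different sides of a hyperplane `{x | x j = b j}` and the interior of
their union is connected, then they touch along overlapping facets. -/
theorem touching_of_isConnected {a a' : Fin n → ℝ} {s s' : ℝ} (hs : 0 < s) (hs' : 0 < s')
    (hconn : IsConnected (interior
      (closedBox a (fun i => a i + s) ∪ closedBox a' (fun i => a' i + s'))))
    {j : Fin n} (hj : a j + s ≤ a' j) :
    a' j = a j + s ∧ ∀ i, i ≠ j → a i < a' i + s' ∧ a' i < a i + s := by
  set Q := closedBox a (fun i => a i + s) with hQ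
  set Q' := closedBox a' (fun i => a' i + s') with hQ'
  have hcenter : ∀ (c : Fin n → ℝ) (t : ℝ), 0 < t → closedBox c (fun i => c i + t) ⊆ Q ∪ Q' →
      WithLp.toLp 2 (fun i => c i + t / 2) ∈ interior (Q ∪ Q') := fun c t ht hc =>
    mem_interior.2 ⟨_, (ball_subset_closedBox (r := t / 2) fun i => by
      constructor <;> simp only <;> linarith).trans hc, isOpen_ball, mem_ball_self (by positivity)⟩
  obtain ⟨x, hx, hxj⟩ := hconn.isPreconnected.intermediate_value
    (hcenter a s hs subset_union_left) (hcenter a' s' hs' subset_union_right)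
    (f := fun y : En n => y j) (Continuous.continuousOn (by fun_prop))
    (show a j + s ∈ Icc (a j + s / 2) (a' j + s' / 2) from ⟨by linarith, by linarith⟩)
  obtain ⟨ε, hε, hball⟩ := Metric.isOpen_iff.1 isOpen_interior x hx
  have hmove : ∀ i σ τ, |σ| + |τ| < ε →
      x + EuclideanSpace.single j σ + EuclideanSpace.single i τ ∈ Q ∪ Q' := fun i σ τ h => by
    refine interior_subset (hball ?_)
    rw [mem_ball, dist_eq_norm, add_assoc, add_sub_cancel_left]
    refine (norm_add_le _ _).trans_lt ?_
    simpa using h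
  have hright : ∀ i σ τ, 0 < σ → σ + |τ| < ε → (i = j → τ = 0) →
      x + EuclideanSpace.single j σ + EuclideanSpace.single i τ ∈ Q' := fun i σ τ hσ h hi => by
    refine (hmove i σ τ (by rwa [abs_of_pos hσ])).resolve_left fun hc => ?_
    have h1 := (hc j).2
    by_cases hij : i = j
    · simp [hi hij, hxj] at h1; linarith
    · simp [hxj, Ne.symm hij] at h1; linarith
  have hj' : a' j ≤ a j + s := by
    refine le_of_forall_pos_lt_add fun δ hδ => ?_
    have hm : 0 < min (δ / 2) (ε / 2) := by positivity
    have h1 := (hright j (min (δ / 2) (ε / 2)) 0 hm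
      (by simpa using Or.inr (half_lt_self hε)) fun _ => rfl) j
    have h2 := h1.1
    simp [hxj] at h2
    have h3 := min_le_left (δ / 2) (ε / 2)
    linarith
  refine ⟨le_antisymm hj' hj, fun i hij => ?_⟩
  have hleft : ∀ σ τ, 0 < σ → σ + |τ| < ε →
      x + EuclideanSpace.single j (-σ) + EuclideanSpace.single i τ ∈ Q := fun σ τ hσ h => by
    refine (hmove i (-σ) τ (by rwa [abs_neg, abs_of_pos hσ])).resolve_right fun hc => ?_
    have h1 := (hc j).1
    simp [hxj, Ne.symm hij] at h1
    linarith
  have hε3 : 0 < ε / 3 := by positivity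
  have hlt : ∀ τ, |τ| = ε / 3 → ε / 3 + |τ| < ε := fun τ hτ => by rw [hτ]; linarith
  have hp : |ε / 3| = ε / 3 := abs_of_pos hε3
  have hq : |-(ε / 3)| = ε / 3 := by rw [abs_neg, hp]
  have h1 := (hright i _ _ hε3 (hlt _ hq) fun h => absurd h hij) i
  have h2 := (hright i _ _ hε3 (hlt _ hp) fun h => absurd h hij) i
  have h3 := (hleft _ _ hε3 (hlt _ hq)) i
  have h4 := (hleft _ _ hε3 (hlt _ hp)) i
  simp [hij] at h1 h2 h3 h4
  constructor <;> linarith [h1.1, h2.2, h3.1, h4.2]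

/-- The closed box whose corners are the integer vectors `M` and `K` scaled by `l`. -/
def latticeBox (l : ℝ) (M K : Fin n → ℤ) : Set (En n) :=
  closedBox (fun i => M i * l) (fun i => K i * l)

theorem latticeBox_subset {l : ℝ} (hl : 0 ≤ l) {M K M' K' : Fin n → ℤ}
    (h : ∀ i, M i ≤ M' i ∧ K' i ≤ K i) : latticeBox l M' K' ⊆ latticeBox l M K := by
  intro x hx i
  have h1 : (M i : ℝ) ≤ M' i := by exact_mod_cast (h i).1
  have h2 : (K' i : ℝ) ≤ K i := by exact_mod_cast (h i).2
  exact ⟨(mul_le_mul_of_nonneg_right h1 hl).trans (hx i).1,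
    (hx i).2.trans (mul_le_mul_of_nonneg_right h2 hl)⟩

theorem norm_sub_le_of_mem_latticeBox {l : ℝ} (hl : 0 ≤ l) {M K : Fin n → ℤ}
    (h : ∀ i, K i ≤ M i + 4) {x y : En n} (hx : x ∈ latticeBox l M K)
    (hy : y ∈ latticeBox l M K) : ‖x - y‖ ≤ (n + 1) * (4 * l) := by
  refine norm_sub_le_of_mem_closedBox (by positivity) (fun i => ?_) hx hy
  have h1 : (K i : ℝ) ≤ M i + 4 := by exact_mod_cast h i
  nlinarith

/-- The Poincaré inequality for two lattice boxes, given a third one that contains the second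
box, is contained in the union, and shares a unit lattice cube with the first box. -/
theorem poincare_latticeBox {l : ℝ} (hl : 0 < l) {M K M' K' P S Z : Fin n → ℤ}
    (hMK : ∀ i, K i ≤ M i + 4) (hPS : ∀ i, S i ≤ P i + 4)
    (hR : latticeBox l M' K' ⊆ latticeBox l P S)
    (hRU : latticeBox l P S ⊆ latticeBox l M K ∪ latticeBox l M' K')
    (hZ : ∀ i, M i ≤ Z i ∧ Z i + 1 ≤ K i) (hZ' : ∀ i, P i ≤ Z i ∧ Z i + 1 ≤ S i)
    {Ω : Set (En n)} (hΩ : Ω = interior (latticeBox l M K ∪ latticeBox l M' K'))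
    {u : En n → ℝ} (hum : Measurable u) (hu : IntegrableOn u Ω) (htv : tvE Ω u ≠ ⊤) :
    ∫ y in Ω, |u y - (∫ z in Ω, u z) / (volume Ω).toReal| ≤
      4 * (16 * (n + 1)) ^ n * (4 * (n + 1)) * l * (tvE Ω u).toReal := by
  have hconv : ∀ M K : Fin n → ℤ, Convex ℝ (latticeBox l M K) := fun M K => convex_closedBox _ _
  have hfr : ∀ M K : Fin n → ℤ, volume (frontier (latticeBox l M K)) = 0 := fun M K =>
    (hconv M K).addHaar_frontier volume
  have hcov : Ω \ (interior (latticeBox l M K) ∪ interior (latticeBox l P S)) ⊆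
      frontier (latticeBox l M K) ∪ frontier (latticeBox l M' K') := by
    rintro x ⟨hx, hx'⟩
    rw [hΩ] at hx
    rcases interior_subset hx with h | h
    · exact Or.inl ⟨subset_closure h, fun hc => hx' (Or.inl hc)⟩
    · exact Or.inr ⟨subset_closure h, fun hc => hx' (Or.inr (interior_mono hR hc))⟩
  have hbdd : ∀ M K : Fin n → ℤ, (∀ i, K i ≤ M i + 4) → Bornology.IsBounded (latticeBox l M K) :=
    fun M K h => Metric.isBounded_iff.2 ⟨_, fun x hx y hy => by
      rw [dist_eq_norm]; exact norm_sub_le_of_mem_latticeBox hl.le h hx hy⟩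
  have hfin : volume Ω ≠ ⊤ := by
    refine (((hbdd M K hMK).union (hbdd P S hPS)).subset ?_).measure_lt_top.ne
    rw [hΩ]
    exact interior_subset.trans (union_subset_union_right _ hR)
  have hz : closedBall (WithLp.toLp 2 fun i => ((Z i : ℝ) + 1 / 2) * l) (l / 4) ⊆
      interior (latticeBox l M K) ∩ interior (latticeBox l P S) := by
    refine (closedBall_subset_ball (by linarith : l / 4 < l / 2)).trans ?_
    have hb : ball (WithLp.toLp 2 fun i => ((Z i : ℝ) + 1 / 2) * l) (l / 2) ⊆
        latticeBox l Z (fun i => Z i + 1) :=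
      ball_subset_closedBox fun i => by constructor <;> push_cast <;> linarith
    exact subset_inter
      (interior_maximal (hb.trans (latticeBox_subset hl.le hZ)) isOpen_ball)
      (interior_maximal (hb.trans (latticeBox_subset hl.le hZ')) isOpen_ball)
  have hn : (0 : ℝ) < n + 1 := by positivity
  have key := setIntegral_abs_sub_mean_le_of_cover hfin isOpen_interior (hconv M K).interior
    (hΩ ▸ interior_mono subset_union_left) isOpen_interior (hconv P S).interior
    (hΩ ▸ interior_mono hRU)
    (measure_mono_null hcov (measure_union_null (hfr _ _) (hfr _ _)))
    (by positivity : 0 < l / 4) (by positivity : 0 < (n + 1) * (4 * l))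
    (fun x hx y hy => norm_sub_le_of_mem_latticeBox hl.le hMK (interior_subset hx)
      (interior_subset hy))
    (fun x hx y hy => norm_sub_le_of_mem_latticeBox hl.le hPS (interior_subset hx)
      (interior_subset hy)) hz hum hu htv
  have h1 : (n + 1) * (4 * l) / (l / 4) = 16 * ((n : ℝ) + 1) := by field_simp; ring
  rw [h1] at key
  linarith

theorem poincare_lattice_cubes {l : ℝ} (hl : 0 < l) {N : ℤ} (hN : 1 ≤ N) (hN4 : N ≤ 4)
    {M M' : Fin n → ℤ} {Ω : Set (En n)}
    (hΩ : Ω = interior (latticeBox l M (fun i => M i + N) ∪ latticeBox l M' (fun i => M' i + 1)))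
    (hconn : IsConnected Ω) {u : En n → ℝ} (hum : Measurable u) (hu : IntegrableOn u Ω)
    (htv : tvE Ω u ≠ ⊤) :
    ∫ y in Ω, |u y - (∫ z in Ω, u z) / (volume Ω).toReal| ≤
      4 * (16 * (n + 1)) ^ n * (4 * (n + 1)) * l * (tvE Ω u).toReal := by
  have hbox : ∀ (M : Fin n → ℤ) (N : ℤ), latticeBox l M (fun i => M i + N) =
      closedBox (fun i => M i * l) (fun i => M i * l + N * l) := fun M N => by
    simp only [latticeBox, Int.cast_add, add_mul]
  have hNl : 0 < (N : ℝ) * l := mul_pos (by exact_mod_cast (by omega : 0 < N)) hl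
  have h1l : 0 < ((1 : ℤ) : ℝ) * l := by simpa using hl
  have hlt : ∀ {p q : ℤ}, (p : ℝ) * l < q * l → p < q := fun h => by
    exact_mod_cast lt_of_mul_lt_mul_right h hl.le
  have hle : ∀ {p q : ℤ}, p ≤ q → (p : ℝ) * l ≤ q * l := fun h =>
    mul_le_mul_of_nonneg_right (by exact_mod_cast h) hl.le
  by_cases hnest : ∀ i, M i ≤ M' i ∧ M' i + 1 ≤ M i + N
  · exact poincare_latticeBox hl (fun i => by omega) (fun i => by omega)
      (latticeBox_subset hl.le hnest) subset_union_left hnest hnest hΩ hum hu htv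
  push Not at hnest
  obtain ⟨j, hj⟩ := hnest
  rcases lt_or_ge (M' j) (M j) with hlr | hlr
  · have hc := hconn
    rw [hΩ, union_comm, hbox, hbox] at hc
    obtain ⟨h1, h2⟩ := touching_of_isConnected h1l hNl hc (j := j) (by
      rw [← add_mul, ← Int.cast_add]; exact hle hlr)
    have hj1 : M j = M' j + 1 := by
      rw [← add_mul, ← Int.cast_add] at h1
      exact_mod_cast mul_right_cancel₀ hl.ne' h1
    have hi : ∀ i, i ≠ j → M i ≤ M' i ∧ M' i + 1 ≤ M i + N := fun i hij => by
      have h3 := h2 i hij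
      rw [← add_mul, ← add_mul, ← Int.cast_add, ← Int.cast_add] at h3
      have := hlt h3.1
      have := hlt h3.2
      omega
    refine poincare_latticeBox hl (P := M') (S := Function.update (fun i => M' i + 1) j (M' j + 2))
      (Z := Function.update M' j (M j)) (fun i => by omega) (fun i => ?_)
      (latticeBox_subset hl.le fun i => ⟨le_rfl, ?_⟩) (fun x hx => ?_) (fun i => ?_)
      (fun i => ?_) hΩ hum hu htv
    · rcases eq_or_ne i j with rfl | hij <;> simp [*]
    · rcases eq_or_ne i j with rfl | hij <;> simp [*]
    · rcases le_total (x j) (M j * l) with hxj | hxj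
      · refine Or.inr fun i => ?_
        have hxi := hx i
        rcases eq_or_ne i j with rfl | hij
        · exact ⟨hxi.1, hxj.trans (hle hj1.le)⟩
        · simpa [hij] using hxi
      · refine Or.inl fun i => ?_
        have hxi := hx i
        rcases eq_or_ne i j with rfl | hij
        · refine ⟨hxj, hxi.2.trans ?_⟩
          simp only [Function.update_self]
          exact hle (by omega)
        · simp only [Function.update_of_ne hij] at hxi
          exact ⟨(hle (hi i hij).1).trans hxi.1, hxi.2.trans (hle (hi i hij).2)⟩
    · rcases eq_or_ne i j with rfl | hij
      · simp only [Function.update_self]; omega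
      · simpa only [Function.update_of_ne hij] using hi i hij
    · rcases eq_or_ne i j with rfl | hij
      · simp only [Function.update_self]; omega
      · simp [Function.update_of_ne hij]
  · have hjr := hj hlr
    have hc := hconn
    rw [hΩ, hbox, hbox] at hc
    obtain ⟨h1, h2⟩ := touching_of_isConnected hNl h1l hc (j := j) (by
      rw [← add_mul, ← Int.cast_add]; exact hle (by omega))
    have hj1 : M' j = M j + N := by
      rw [← add_mul, ← Int.cast_add] at h1
      exact_mod_cast mul_right_cancel₀ hl.ne' h1
    have hi : ∀ i, i ≠ j → M i ≤ M' i ∧ M' i + 1 ≤ M i + N := fun i hij => by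
      have h3 := h2 i hij
      rw [← add_mul, ← add_mul, ← Int.cast_add, ← Int.cast_add] at h3
      have := hlt h3.1
      have := hlt h3.2
      omega
    refine poincare_latticeBox hl (P := Function.update M' j (M' j - 1)) (S := fun i => M' i + 1)
      (Z := Function.update M' j (M' j - 1)) (fun i => by omega) (fun i => ?_)
      (latticeBox_subset hl.le fun i => ⟨?_, le_rfl⟩) (fun x hx => ?_) (fun i => ?_)
      (fun i => ?_) hΩ hum hu htv
    · rcases eq_or_ne i j with rfl | hij
      · simp only [Function.update_self]; omega
      · simp [Function.update_of_ne hij]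
    · rcases eq_or_ne i j with rfl | hij <;> simp [*]
    · rcases le_total (x j) (M' j * l) with hxj | hxj
      · refine Or.inl fun i => ?_
        have hxi := hx i
        rcases eq_or_ne i j with rfl | hij
        · refine ⟨le_trans ?_ hxi.1, hxj.trans (hle hj1.le)⟩
          simp only [Function.update_self]
          exact hle (by omega)
        · simp only [Function.update_of_ne hij] at hxi
          exact ⟨(hle (hi i hij).1).trans hxi.1, hxi.2.trans (hle (hi i hij).2)⟩
      · refine Or.inr fun i => ?_
        have hxi := hx i
        rcases eq_or_ne i j with rfl | hij
        · exact ⟨hxj, hxi.2⟩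
        · simpa [hij] using hxi
    · rcases eq_or_ne i j with rfl | hij
      · simp only [Function.update_self]; omega
      · simpa only [Function.update_of_ne hij] using hi i hij
    · rcases eq_or_ne i j with rfl | hij
      · simp only [Function.update_self]; omega
      · simp [Function.update_of_ne hij]

theorem dyadicCube_eq_latticeBox {k k' : ℤ} (m : Fin n → ℤ) {N : ℤ}
    (hN : (2 : ℝ) ^ (-k) = N * (2 : ℝ) ^ (-k')) :
    dyadicCube k m = latticeBox ((2 : ℝ) ^ (-k')) (fun i => m i * N) (fun i => m i * N + N) := by
  ext x
  simp only [dyadicCube, latticeBox, closedBox, mem_ofPred_eq, hN]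
  push_cast
  refine forall_congr' fun i => ?_
  rw [← mul_assoc, ← mul_assoc, add_mul ((m i : ℝ)) 1, one_mul]

/-- The case of the dyadic Poincaré inequality where the second cube is the smaller one. -/
theorem poincare_dyadicCube_of_le {k k' : ℤ} (hk : k ≤ k') {m m' : Fin n → ℤ}
    (h4 : (2 : ℝ) ^ (-k) ≤ 4 * (2 : ℝ) ^ (-k')) {Ω : Set (En n)}
    (hΩ : Ω = interior (dyadicCube k m ∪ dyadicCube k' m')) (hconn : IsConnected Ω)
    {u : En n → ℝ} (hum : Measurable u) (hu : IntegrableOn u Ω) (htv : tvE Ω u ≠ ⊤) :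
    ∫ y in Ω, |u y - (∫ z in Ω, u z) / (volume Ω).toReal| ≤
      4 * (16 * (n + 1)) ^ n * (4 * (n + 1)) * (2 : ℝ) ^ (-k') * (tvE Ω u).toReal := by
  have hl : (0 : ℝ) < 2 ^ (-k') := by positivity
  obtain ⟨p, hp⟩ := Int.eq_ofNat_of_zero_le (sub_nonneg.2 hk)
  have hN : (2 : ℝ) ^ (-k) = ((2 ^ p : ℤ) : ℝ) * (2 : ℝ) ^ (-k') := by
    push_cast
    rw [← zpow_natCast, ← zpow_add₀ two_ne_zero]
    congr 1
    omega
  have hN4 : (2 ^ p : ℤ) ≤ 4 := by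
    rw [hN] at h4
    exact_mod_cast le_of_mul_le_mul_right h4 hl
  rw [dyadicCube_eq_latticeBox m hN, dyadicCube_eq_latticeBox (k := k') (k' := k') m' (N := 1)
    (by simp)] at hΩ
  exact poincare_lattice_cubes hl (one_le_pow₀ (by norm_num)) hN4 hΩ hconn hum hu htv

theorem tvE_congr_ae {Ω : Set (En n)} {u v : En n → ℝ} (h : u =ᵐ[volume.restrict Ω] v) :
    tvE Ω u = tvE Ω v := by
  refine iSup_congr fun φ => iSup_congr fun _ => congrArg ENNReal.ofReal ?_
  refine integral_congr_ae ?_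
  filter_upwards [h] with x hx
  rw [hx]

/-- **Poincaré inequality on unions of two neighbouring dyadic cubes.** There is a
constant `C > 0` depending only on `n` such that: if `Q, Q'` are closed dyadic cubes
with `(1/4)·l(Q') ≤ l(Q) ≤ 4·l(Q')` and `Ω := int(Q ∪ Q')` is connected, then
`∫_Ω |u - u_Ω| ≤ C·l(Q)·‖Du‖(Ω)` for every `u ∈ BV(Ω)`. -/
theorem bv_poincare_dyadic_cubes (n : ℕ) :
    ∃ C : ℝ, 0 < C ∧ ∀ (k k' : ℤ) (m m' : Fin n → ℤ),
      (1 / 4 : ℝ) * (2 : ℝ) ^ (-k') ≤ (2 : ℝ) ^ (-k) →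
      (2 : ℝ) ^ (-k) ≤ 4 * (2 : ℝ) ^ (-k') →
      ∀ Ω : Set (En n), Ω = interior (dyadicCube k m ∪ dyadicCube k' m') →
      IsConnected Ω →
      ∀ u : En n → ℝ, MemBV Ω u →
        (∫ y in Ω, |u y - (∫ z in Ω, u z) / (volume Ω).toReal|)
          ≤ C * (2 : ℝ) ^ (-k) * (tvE Ω u).toReal := by
  refine ⟨4 * (16 * (n + 1)) ^ n * (4 * (n + 1)), by positivity, ?_⟩
  intro k k' m m' h4' h4 Ω hΩ hconn u hu
  obtain ⟨v, hvm, huv⟩ : ∃ v : En n → ℝ, Measurable v ∧ u =ᵐ[volume.restrict Ω] v :=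
    ⟨_, hu.1.aestronglyMeasurable.stronglyMeasurable_mk.measurable,
      hu.1.aestronglyMeasurable.ae_eq_mk⟩
  have hvi : IntegrableOn v Ω := hu.1.congr huv
  have htv : tvE Ω v ≠ ⊤ := tvE_congr_ae huv ▸ hu.2.ne
  have hLHS : (∫ y in Ω, |u y - (∫ z in Ω, u z) / (volume Ω).toReal|) =
      ∫ y in Ω, |v y - (∫ z in Ω, v z) / (volume Ω).toReal| := by
    rw [integral_congr_ae huv]
    refine integral_congr_ae ?_
    filter_upwards [huv] with x hx
    rw [hx]
  rw [hLHS, tvE_congr_ae huv]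
  rcases le_total k k' with hk | hk
  · refine (poincare_dyadicCube_of_le hk h4 hΩ hconn hvm hvi htv).trans ?_
    gcongr
    norm_num
  · rw [union_comm] at hΩ
    exact poincare_dyadicCube_of_le hk (by linarith) hΩ hconn hvm hvi htv

end
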